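/- Let p be a prime and let G1 and G2 be finite p-groups with G1 abelian. Suppose there is a bijection φ : G1 → G2 such that for every subset X of G1, X is independent in G1 if and only if φ(X) is independent in G2, or a bijection φ : G1 → G2 such that for every subset X of G1, X is strongly independent in G1 if and only if φ(X) is strongly independent in G2. Then every subgroup K of G2 with d(K) = 2 is metacyclic, i.e., K has a cyclic normal subgroup N such that K/N is cyclic. -/

import Mathlib

/-- A subset `X` of a group is independent if no element of `X` lies in the
subgroup generated by the other elements of `X`. -/
def Independent {G : Type*} [Group G] (X : Set G) : Prop :=
  ∀ x ∈ X, x ∉ Subgroup.closure (X \ {x})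

/-- `dgen H` is the least cardinality of a generating set of the subgroup `H`. -/
noncomputable def dgen {G : Type*} [Group G] (H : Subgroup G) : ℕ :=
  sInf {n : ℕ | ∃ S : Set G, S.Finite ∧ S ⊆ (H : Set G) ∧ Subgroup.closure S = H ∧ S.ncard = n}

/-- A subset `X` of a group is strongly independent if every subgroup `H` containing `X`
satisfies `|X| ≤ d(H)`. -/
def StronglyIndependent {G : Type*} [Group G] (X : Set G) : Prop :=
  ∀ H : Subgroup G, X ⊆ (H : Set G) → X.ncard ≤ dgen H

/-- A group is hamiltonian if it is nonabelian and all of its subgroups are normal. -/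
def IsHamiltonian (G : Type*) [Group G] : Prop :=
  (∃ a b : G, a * b ≠ b * a) ∧ ∀ H : Subgroup G, H.Normal

section PGroup

variable {p : ℕ} [Fact p.Prime] {G : Type*} [Group G]

/-- In a `p`-group, an exponent prime to `p` does not change the cyclic subgroup generated. -/
theorem IsPGroup.mem_zpowers_zpow (hG : IsPGroup p G) (g : G) {k : ℤ} (hk : ¬ (p : ℤ) ∣ k) :
    g ∈ Subgroup.zpowers (g ^ k) := by
  obtain ⟨n, hn⟩ := hG g
  have hc : IsCoprime k ((p : ℤ) ^ n) :=
    ((Nat.prime_iff_prime_int.mp Fact.out).coprime_iff_not_dvd.mpr hk).symm.pow_right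
  obtain ⟨u, v, huv⟩ := hc
  refine ⟨u, ?_⟩
  have h1 : g ^ ((p : ℤ) ^ n) = 1 := by exact_mod_cast hn
  calc (g ^ k) ^ u = g ^ (u * k) := by rw [← zpow_mul, mul_comm]
    _ = g ^ (u * k) * (g ^ ((p : ℤ) ^ n)) ^ v := by rw [h1, one_zpow, mul_one]
    _ = g := by rw [← zpow_mul, ← zpow_add, mul_comm _ v, huv, zpow_one]

/-- An element of a cyclic `p`-group generates it or is a power of the `p`-th power of a
generator. -/
theorem IsPGroup.mem_zpowers_or_mem_zpowers_pow (hG : IsPGroup p G) {g x : G}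
    (hx : x ∈ Subgroup.zpowers g) :
    g ∈ Subgroup.zpowers x ∨ x ∈ Subgroup.zpowers (g ^ p) := by
  obtain ⟨k, rfl⟩ := hx
  by_cases hk : (p : ℤ) ∣ k
  · obtain ⟨l, rfl⟩ := hk
    exact Or.inr ⟨l, by simp [zpow_mul]⟩
  · exact Or.inl (hG.mem_zpowers_zpow g hk)

theorem IsPGroup.eq_one_of_mem_zpowers_pow (hG : IsPGroup p G) {g : G}
    (h : g ∈ Subgroup.zpowers (g ^ p)) : g = 1 := by
  obtain ⟨k, hk⟩ := h
  have hk' : g ^ ((p : ℤ) * k - 1) = 1 := by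
    rw [zpow_sub_one, zpow_mul, zpow_natCast]
    exact mul_inv_eq_one.mpr hk
  have hp : ¬ (p : ℤ) ∣ (p : ℤ) * k - 1 := fun hd =>
    (Nat.prime_iff_prime_int.mp (Fact.out : p.Prime)).not_dvd_one
      ((dvd_sub_right (dvd_mul_right _ k)).mp hd)
  simpa [hk'] using hG.mem_zpowers_zpow g hp

theorem IsPGroup.zpowers_pow_lt (hG : IsPGroup p G) {g : G} (hg : g ≠ 1) :
    Subgroup.zpowers (g ^ p) < Subgroup.zpowers g := by
  refine lt_of_le_of_ne ?_ fun h => hg ?_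
  · rw [Subgroup.zpowers_le]
    exact Subgroup.npow_mem_zpowers g p
  · exact hG.eq_one_of_mem_zpowers_pow (h ▸ Subgroup.mem_zpowers g)

/-- The elements of a cyclic `p`-group are linearly ordered by divisibility. -/
theorem IsPGroup.mem_zpowers_total [Finite G] (hG : IsPGroup p G) {g x y : G}
    (hx : x ∈ Subgroup.zpowers g) (hy : y ∈ Subgroup.zpowers g) :
    x ∈ Subgroup.zpowers y ∨ y ∈ Subgroup.zpowers x := by
  induction hn : Nat.card (Subgroup.zpowers g) using Nat.strong_induction_on generalizing g with
  | _ n ih =>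
    by_cases hg : g = 1
    · subst hg
      obtain rfl : x = 1 := by simpa using hx
      exact Or.inl (one_mem _)
    rcases hG.mem_zpowers_or_mem_zpowers_pow hx with h | hx'
    · exact Or.inr (Subgroup.zpowers_le.mpr h hy)
    rcases hG.mem_zpowers_or_mem_zpowers_pow hy with h | hy'
    · exact Or.inl (Subgroup.zpowers_le.mpr h hx)
    refine ih _ ?_ hx' hy' rfl
    rw [← hn]
    exact Set.ncard_lt_ncard (hG.zpowers_pow_lt hg)

/-- Every `p`-th power of a finite `p`-group lies in the Frattini subgroup. -/
theorem IsPGroup.pow_mem_frattini [Finite G] (hG : IsPGroup p G) (x : G) :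
    x ^ p ∈ frattini G := by
  have := hG.isNilpotent
  rw [frattini, Order.radical, Subgroup.mem_iInf]
  intro M
  rw [Subgroup.mem_iInf]
  intro hM
  have hN : M.Normal :=
    Subgroup.NormalizerCondition.normal_of_coatom M Group.normalizerCondition_of_isNilpotent hM
  by_contra hx
  have htop : M ⊔ Subgroup.zpowers (x ^ p) = ⊤ :=
    hM.2 _ (lt_of_le_of_ne le_sup_left fun h => hx (by
      rw [h]; exact Subgroup.mem_sup_right (Subgroup.mem_zpowers _)))
  obtain ⟨m, hm, y, ⟨k, rfl⟩, hy⟩ :=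
    Subgroup.mem_sup_of_normal_left.mp (htop ▸ Subgroup.mem_top x)
  have h1 : x ^ (1 - (p : ℤ) * k) ∈ M := by
    have h2 : m = x * ((x ^ p) ^ k)⁻¹ := eq_mul_inv_of_mul_eq hy
    rw [sub_eq_add_neg, zpow_add, zpow_one, zpow_neg, zpow_mul, zpow_natCast, ← h2]
    exact hm
  have h3 : ¬ (p : ℤ) ∣ 1 - (p : ℤ) * k := fun hd =>
    (Nat.prime_iff_prime_int.mp (Fact.out : p.Prime)).not_dvd_one
      ((dvd_sub_left (dvd_mul_right _ k)).mp hd)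
  exact hx (M.pow_mem (Subgroup.zpowers_le.mpr h1 (hG.mem_zpowers_zpow x h3)) p)

end PGroup

theorem commute_of_closure_pair_eq_top {G : Type*} [Group G] {a b : G}
    (hab : Subgroup.closure {a, b} = ⊤) (h : Commute a b) (x y : G) : Commute x y := by
  have := Subgroup.isMulCommutative_closure (k := {a, b}) (by
    rintro x (rfl | rfl) y (rfl | rfl)
    exacts [rfl, h.eq, h.eq.symm, rfl])
  rw [hab] at this
  exact congrArg Subtype.val (this.1.comm ⟨x, Subgroup.mem_top x⟩ ⟨y, Subgroup.mem_top y⟩)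

theorem closure_pair_quotient_eq_top {G : Type*} [Group G] {a b : G}
    (hab : Subgroup.closure {a, b} = ⊤) (N : Subgroup G) [N.Normal] :
    Subgroup.closure {(a : G ⧸ N), (b : G ⧸ N)} = ⊤ := by
  have := congrArg (Subgroup.map (QuotientGroup.mk' N)) hab
  rw [MonoidHom.map_closure, Set.image_pair,
    Subgroup.map_top_of_surjective _ (QuotientGroup.mk'_surjective N)] at this
  exact this

theorem closure_pair_eq_top_of_quotient {G : Type*} [Group G] [Finite G] {a b : G}
    {N : Subgroup G} [N.Normal] (hN : N ≤ frattini G)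
    (hab : Subgroup.closure {(a : G ⧸ N), (b : G ⧸ N)} = ⊤) : Subgroup.closure {a, b} = ⊤ := by
  apply frattini_nongenerating
  rw [eq_top_iff]
  refine le_trans ?_ (sup_le_sup_left hN _)
  have h := Subgroup.comap_map_eq (QuotientGroup.mk' N) (Subgroup.closure {a, b})
  rw [MonoidHom.map_closure, Set.image_pair, QuotientGroup.mk'_apply, QuotientGroup.mk'_apply,
    hab, QuotientGroup.ker_mk', Subgroup.comap_top] at h
  exact h.le

theorem commutator_le_of_closure_pair {G : Type*} [Group G] {a b : G}
    (hab : Subgroup.closure {a, b} = ⊤) {N : Subgroup G} [N.Normal]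
    (h : a * b * a⁻¹ * b⁻¹ ∈ N) : commutator G ≤ N := by
  rw [← Subgroup.Normal.quotient_commutative_iff_commutator_le]
  have hab' : Subgroup.closure {(a : G ⧸ N), (b : G ⧸ N)} = ⊤ :=
    closure_pair_quotient_eq_top hab N
  refine ⟨⟨fun x y => (commute_of_closure_pair_eq_top hab' ?_ x y).eq⟩⟩
  have h1 : ((a * b * a⁻¹ * b⁻¹ : G) : G ⧸ N) = 1 := (QuotientGroup.eq_one_iff _).mpr h
  exact mul_inv_eq_iff_eq_mul.mp (mul_inv_eq_one.mp h1)

theorem Subgroup.normal_of_closure_pair {G : Type*} [Group G] [Finite G] {a b : G}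
    (hab : Subgroup.closure {a, b} = ⊤) {N : Subgroup G}
    (ha : ∀ x ∈ N, a * x * a⁻¹ ∈ N) (hb : ∀ x ∈ N, b * x * b⁻¹ ∈ N) : N.Normal := by
  rw [← Subgroup.normalizer_eq_top_iff, ← top_le_iff, ← hab, Subgroup.closure_le]
  rintro x (rfl | rfl)
  exacts [Subgroup.mem_normalizer_fintype ha, Subgroup.mem_normalizer_fintype hb]

section PowerClosed

variable {p : ℕ} [Fact p.Prime] {G : Type*} [Group G]

/-- The subgroup of `p`-th powers, when these are closed under multiplication. -/
def powSubgroup (p : ℕ) (hmul : ∀ x y : G, ∃ z, z ^ p = x ^ p * y ^ p) : Subgroup G where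
  carrier := {x | ∃ z, z ^ p = x}
  mul_mem' := by
    rintro _ _ ⟨x, rfl⟩ ⟨y, rfl⟩
    exact hmul x y
  one_mem' := ⟨1, one_pow p⟩
  inv_mem' := by
    rintro _ ⟨x, rfl⟩
    exact ⟨x⁻¹, inv_pow x p⟩

/-- In a two-generated `p`-group whose commutators and products of `p`-th powers are `p`-th
powers, an element which is not a `p`-th power belongs to a generating pair. -/
theorem exists_closure_pair_eq_top [Finite G] (hG : IsPGroup p G)
    (hmul : ∀ x y : G, ∃ z, z ^ p = x ^ p * y ^ p)
    (hcomm : ∀ x ∈ commutator G, ∃ z, z ^ p = x) {a b g : G}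
    (hab : Subgroup.closure {a, b} = ⊤) (hg : ¬ ∃ z, z ^ p = g) :
    ∃ h, Subgroup.closure {g, h} = ⊤ := by
  set V := powSubgroup p hmul with hV
  have hVF : V ≤ frattini G := by
    rintro _ ⟨z, rfl⟩
    exact hG.pow_mem_frattini z
  have hcV : commutator G ≤ V := hcomm
  have : V.Normal := Subgroup.Normal.of_commutator_le G hcV
  have := Subgroup.Normal.quotient_commutative_iff_commutator_le.mpr hcV
  let _ : CommGroup (G ⧸ V) := { mul_comm := this.1.comm }
  have hab' : Subgroup.closure {(a : G ⧸ V), (b : G ⧸ V)} = ⊤ :=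
    closure_pair_quotient_eq_top hab V
  have hexp : ∀ x : G ⧸ V, x ^ p = 1 := by
    intro x
    induction x using QuotientGroup.induction_on with
    | H x => exact (QuotientGroup.eq_one_iff _).mpr ⟨x, rfl⟩
  have hQ : IsPGroup p (G ⧸ V) := hG.to_quotient V
  have lift : ∀ h : G, Subgroup.closure {(g : G ⧸ V), (h : G ⧸ V)} = ⊤ →
      Subgroup.closure {g, h} = ⊤ := fun h => closure_pair_eq_top_of_quotient hVF
  have hgab : (g : G ⧸ V) ∈ Subgroup.closure {(a : G ⧸ V), (b : G ⧸ V)} :=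
    hab' ▸ Subgroup.mem_top _
  obtain ⟨i, j, hij⟩ := Subgroup.mem_closure_pair.mp hgab
  have key : ∀ x : G ⧸ V, ∀ k : ℤ, (p : ℤ) ∣ k → x ^ k = 1 := by
    rintro x _ ⟨l, rfl⟩
    rw [zpow_mul, zpow_natCast, hexp, one_zpow]
  by_cases hi : (p : ℤ) ∣ i
  · have hj : ¬ (p : ℤ) ∣ j := by
      intro hj
      rw [key _ _ hi, key _ _ hj, mul_one] at hij
      exact hg ((QuotientGroup.eq_one_iff _).mp hij.symm)
    refine ⟨a, lift a ?_⟩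
    rw [eq_top_iff, ← hab', Subgroup.closure_le]
    rintro x (rfl | rfl)
    · exact Subgroup.subset_closure (by simp)
    · refine Subgroup.zpowers_le.mpr ?_ (hQ.mem_zpowers_zpow _ hj)
      rw [key _ _ hi, one_mul] at hij
      rw [hij]
      exact Subgroup.subset_closure (by simp)
  · refine ⟨b, lift b ?_⟩
    rw [eq_top_iff, ← hab', Subgroup.closure_le]
    rintro x (rfl | rfl)
    · refine Subgroup.zpowers_le.mpr ?_ (hQ.mem_zpowers_zpow _ hi)
      rw [← eq_mul_inv_iff_mul_eq] at hij
      rw [hij]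
      exact mul_mem (Subgroup.subset_closure (by simp))
        (inv_mem (zpow_mem (Subgroup.subset_closure (by simp)) _))
    · exact Subgroup.subset_closure (by simp)

/-- A nontrivial normal subgroup of a finite `p`-group contains a central element of order `p`. -/
theorem IsPGroup.exists_central_orderOf_eq [Finite G] (hG : IsPGroup p G) (N : Subgroup G)
    [N.Normal] (hN : N ≠ ⊥) : ∃ z ∈ N, orderOf z = p ∧ ∀ x, Commute x z := by
  have hd : p ∣ Nat.card N := (hG.to_subgroup N).card_eq_or_dvd.resolve_left fun h =>
    hN (Subgroup.card_eq_one.mp h)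
  have hC := hG.of_equiv (ConjAct.toConjAct (G := G))
  obtain ⟨b, hb, hb1⟩ := hC.exists_fixed_point_of_prime_dvd_card_of_fixed_point
    N hd (a := 1) (fun g => smul_one g)
  have hbc : ∀ x : G, Commute x b := fun x => by
    have := congrArg Subtype.val (hb (ConjAct.toConjAct x))
    rw [ConjAct.Subgroup.val_conj_smul, ConjAct.toConjAct_smul] at this
    exact mul_inv_eq_iff_eq_mul.mp this
  have hb1' : (b : G) ≠ 1 := fun h => hb1 (Subtype.ext h.symm)
  refine ⟨b ^ (orderOf (b : G) / p), N.pow_mem b.2 _,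
    orderOf_pow_orderOf_div (orderOf_pos _).ne' (hG.dvd_orderOf hb1'), fun x => (hbc x).pow_right _⟩

end PowerClosed

theorem exists_commutator_le_zpowers {p : ℕ} [Fact p.Prime] (n : ℕ) :
    ∀ {G : Type*} [Group G] [Finite G], Nat.card G = n → IsPGroup p G →
      (∀ x y : G, ∃ z, z ^ p = x ^ p * y ^ p) → (∀ x ∈ commutator G, ∃ z, z ^ p = x) →
      ∀ {a b : G}, Subgroup.closure {a, b} = ⊤ →
      ∃ g h : G, Subgroup.closure {g, h} = ⊤ ∧ commutator G ≤ Subgroup.zpowers g := by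
  induction n using Nat.strong_induction_on with
  | _ n ih =>
  intro G _ _ hn hG hmul hcomm a b hab
  by_cases hc1 : commutator G = ⊥
  · exact ⟨a, b, hab, hc1 ▸ bot_le⟩
  have hVF : ∀ x : G, x ^ p ∈ frattini G := hG.pow_mem_frattini
  obtain ⟨z, hzc, hzp, hz⟩ := hG.exists_central_orderOf_eq (commutator G) hc1
  have hz1 : z ^ p = 1 := hzp ▸ pow_orderOf_eq_one z
  have hZn : (Subgroup.zpowers z).Normal := by
    refine ⟨?_⟩
    rintro _ ⟨k, rfl⟩ x
    refine ⟨k, ?_⟩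
    have := ((hz x).zpow_right k).eq
    rw [this, mul_inv_cancel_right]
  have hZF : Subgroup.zpowers z ≤ frattini G := by
    obtain ⟨w, rfl⟩ := hcomm z hzc
    exact Subgroup.zpowers_le.mpr (hVF w)
  obtain ⟨g, h, hgh, hgK⟩ : ∃ g h : G, Subgroup.closure {g, h} = ⊤ ∧
      ∀ x ∈ commutator G, ∃ k l : ℤ, x = g ^ k * z ^ l := by
    set Q := G ⧸ Subgroup.zpowers z
    have hcard : Nat.card Q < n := by
      rw [← hn, ← Subgroup.card_mul_index (Subgroup.zpowers z), Nat.card_zpowers, hzp]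
      have hpos : 0 < (Subgroup.zpowers z).index :=
        Nat.pos_of_ne_zero Subgroup.index_ne_zero_of_finite
      exact (Nat.lt_mul_iff_one_lt_left hpos).mpr (Fact.out : p.Prime).one_lt
    have hmapc : Subgroup.map (QuotientGroup.mk' (Subgroup.zpowers z)) (commutator G)
        = commutator Q := by
      rw [commutator_def, Subgroup.map_commutator,
        Subgroup.map_top_of_surjective _ (QuotientGroup.mk'_surjective _), commutator_def]
    have hmulQ : ∀ x y : Q, ∃ w, w ^ p = x ^ p * y ^ p := by
      intro x y
      induction x using QuotientGroup.induction_on with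
      | H x =>
      induction y using QuotientGroup.induction_on with
      | H y =>
      obtain ⟨w, hw⟩ := hmul x y
      exact ⟨w, congrArg (QuotientGroup.mk' (Subgroup.zpowers z)) hw⟩
    have hcommQ : ∀ x ∈ commutator Q, ∃ w, w ^ p = x := by
      rw [← hmapc]
      rintro _ ⟨x, hx, rfl⟩
      obtain ⟨w, hw⟩ := hcomm x hx
      exact ⟨w, congrArg (QuotientGroup.mk' (Subgroup.zpowers z)) hw⟩
    have habQ : Subgroup.closure {(a : Q), (b : Q)} = ⊤ := closure_pair_quotient_eq_top hab _
    obtain ⟨g', h', hgh', hgK'⟩ := ih _ hcard rfl (hG.to_quotient _) hmulQ hcommQ habQ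
    obtain ⟨g, rfl⟩ := QuotientGroup.mk'_surjective _ g'
    obtain ⟨h, rfl⟩ := QuotientGroup.mk'_surjective _ h'
    refine ⟨g, h, ?_, ?_⟩
    · exact closure_pair_eq_top_of_quotient hZF hgh'
    · intro x hx
      obtain ⟨k, hk⟩ := hgK' (hmapc ▸ Subgroup.mem_map_of_mem _ hx)
      have hk' : ((g ^ k : G) : Q) = (x : Q) := hk
      obtain ⟨l, hl⟩ := QuotientGroup.eq.mp hk'
      exact ⟨k, l, (mul_eq_of_eq_inv_mul hl).symm⟩
  have hmem : h * g * h⁻¹ * g⁻¹ ∈ commutator G :=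
    Subgroup.commutator_mem_commutator (Subgroup.mem_top h) (Subgroup.mem_top g)
  obtain ⟨m, l, hml⟩ := hgK _ hmem
  set c := h * g * h⁻¹ * g⁻¹ with hc
  have hhg : Subgroup.closure {h, g} = ⊤ := Set.pair_comm g h ▸ hgh
  have hgc : Commute g c := by
    rw [hml]
    exact ((Commute.refl g).zpow_right m).mul_right ((hz g).zpow_right l)
  have hgz : h * g * h⁻¹ = c * g := by simp [hc]
  have hhc : h * c * h⁻¹ = c ^ (m + 1) := by
    calc h * c * h⁻¹ = (h * g * h⁻¹) ^ m * (h * z ^ l * h⁻¹) := by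
          rw [hml, conj_zpow]; group
      _ = (c * g) ^ m * z ^ l := by
          rw [hgz, ((hz h).zpow_right l).eq, mul_inv_cancel_right]
      _ = c ^ m * (g ^ m * z ^ l) := by rw [hgc.symm.mul_zpow, mul_assoc]
      _ = c ^ (m + 1) := by rw [← hml, zpow_add, zpow_one]
  have hcn : (Subgroup.zpowers c).Normal := by
    refine Subgroup.normal_of_closure_pair hgh ?_ ?_
    · rintro _ ⟨k, rfl⟩
      refine ⟨k, ?_⟩
      rw [(hgc.zpow_right k).eq, mul_inv_cancel_right]
    · rintro _ ⟨k, rfl⟩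
      refine ⟨(m + 1) * k, ?_⟩
      rw [← conj_zpow, hhc]
      exact zpow_mul c _ k
  have hcle : commutator G ≤ Subgroup.zpowers c :=
    commutator_le_of_closure_pair hhg (Subgroup.mem_zpowers c)
  have hcne : c ≠ 1 := fun h0 => hc1 (le_bot_iff.mp (by simpa [h0] using hcle))
  by_cases hcp : c ^ p = 1
  · have : Nonempty {x : G // c ∈ Subgroup.zpowers x} := ⟨⟨c, Subgroup.mem_zpowers c⟩⟩
    obtain ⟨⟨g', hg'⟩, hmax⟩ := Finite.exists_max
      (fun x : {x : G // c ∈ Subgroup.zpowers x} => Nat.card (Subgroup.zpowers x.1))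
    have hnp : ¬ ∃ w, w ^ p = g' := by
      rintro ⟨w, rfl⟩
      have hcw : c ∈ Subgroup.zpowers w :=
        Subgroup.zpowers_le.mpr (Subgroup.npow_mem_zpowers w p) hg'
      have hw : w ≠ 1 := fun hw => hcne (by simpa [hw] using hcw)
      exact (hmax ⟨w, hcw⟩).not_gt (Set.ncard_lt_ncard (hG.zpowers_pow_lt hw))
    obtain ⟨h', hh'⟩ := exists_closure_pair_eq_top hG hmul hcomm hab hnp
    exact ⟨g', h', hh', hcle.trans (Subgroup.zpowers_le.mpr hg')⟩
  · have hzg : z ∈ Subgroup.zpowers g := by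
      rcases hG.mem_zpowers_or_mem_zpowers_pow (hcle hzc) with ⟨k, hk⟩ | hk
      · refine absurd ?_ hcp
        rw [← hk, ← zpow_natCast, zpow_comm, zpow_natCast, hz1, one_zpow]
      · refine Subgroup.zpowers_le.mpr ?_ hk
        refine ⟨m * p, ?_⟩
        rw [hml, (((hz g).zpow_left m).zpow_right l).mul_pow, ← zpow_natCast (z ^ l), zpow_comm,
          zpow_natCast z, hz1, one_zpow, mul_one]
        simp only [zpow_mul, zpow_natCast]
    refine ⟨g, h, hgh, fun x hx => ?_⟩
    obtain ⟨k, j, rfl⟩ := hgK x hx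
    exact mul_mem (Subgroup.zpow_mem_zpowers g k) (zpow_mem hzg j)

theorem IsPGroup.commutator_le_frattini {p : ℕ} [Fact p.Prime] {G : Type*} [Group G] [Finite G]
    (hG : IsPGroup p G) : commutator G ≤ frattini G := by
  have := hG.isNilpotent
  refine le_iInf₂ fun M (hM : IsCoatom M) => ?_
  have hN : M.Normal :=
    Subgroup.NormalizerCondition.normal_of_coatom M Group.normalizerCondition_of_isNilpotent hM
  obtain ⟨x, -, hx⟩ := SetLike.exists_of_lt hM.lt_top
  have htop : M ⊔ Subgroup.zpowers x = ⊤ :=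
    hM.2 _ (lt_of_le_of_ne le_sup_left fun h => hx (by
      rw [h]; exact Subgroup.mem_sup_right (Subgroup.mem_zpowers _)))
  have hcyc : IsCyclic (G ⧸ M) := by
    refine ⟨(x : G ⧸ M), fun y => ?_⟩
    induction y using QuotientGroup.induction_on with
    | H y =>
    obtain ⟨m, hm, _, ⟨k, rfl⟩, rfl⟩ :=
      Subgroup.mem_sup_of_normal_left.mp (htop ▸ Subgroup.mem_top y)
    refine ⟨k, ?_⟩
    rw [QuotientGroup.mk_mul, (QuotientGroup.eq_one_iff m).mpr hm, one_mul]
    rfl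
  exact Subgroup.Normal.quotient_commutative_iff_commutator_le.mp inferInstance

theorem IsCyclic.exists_cyclic_extension {G : Type*} [Group G] [IsCyclic G] :
    ∃ N : Subgroup G, ∃ _ : N.Normal, IsCyclic N ∧ IsCyclic (G ⧸ N) :=
  ⟨⊥, inferInstance, inferInstance,
    isCyclic_of_surjective (QuotientGroup.mk' ⊥) (QuotientGroup.mk'_surjective _)⟩

theorem IsPGroup.sq_le_index_frattini {p : ℕ} [Fact p.Prime] {G : Type*} [Group G] [Finite G]
    (hG : IsPGroup p G) (hcyc : ¬ IsCyclic G) : p ^ 2 ≤ (frattini G).index := by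
  obtain ⟨n, hn⟩ := hG.index (frattini G)
  rw [hn]
  refine Nat.pow_le_pow_right (Fact.out : p.Prime).pos ?_
  by_contra! hlt
  refine hcyc ?_
  have : IsCyclic (G ⧸ frattini G) := by
    interval_cases n
    · rw [pow_zero, Subgroup.index_eq_card, Nat.card_eq_one_iff_unique] at hn
      have := hn.1
      infer_instance
    · exact isCyclic_of_prime_card (p := p) (by rw [← Subgroup.index_eq_card, hn, pow_one])
  obtain ⟨x, hx⟩ := this.exists_generator
  obtain ⟨x, rfl⟩ := QuotientGroup.mk'_surjective _ x
  have hx' : Subgroup.closure {x, x} = ⊤ := by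
    refine closure_pair_eq_top_of_quotient le_rfl ?_
    rw [Set.pair_eq_singleton, ← Subgroup.zpowers_eq_closure, eq_top_iff]
    exact fun y _ => hx y
  rw [Set.pair_eq_singleton, ← Subgroup.zpowers_eq_closure] at hx'
  refine ⟨x, fun y => ?_⟩
  have := Subgroup.mem_top y
  rwa [← hx'] at this

/-- A two-generated finite `p`-group of order at most `p ^ 2` times the number of its `p`-th powers
is metacyclic. -/
theorem exists_cyclic_extension_of_card_le {p : ℕ} [Fact p.Prime] {G : Type*} [Group G] [Finite G]
    (hG : IsPGroup p G) {a b : G} (hab : Subgroup.closure {a, b} = ⊤)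
    (hcard : Nat.card G ≤ p ^ 2 * (Set.range fun x : G => x ^ p).ncard) :
    ∃ N : Subgroup G, ∃ _ : N.Normal, IsCyclic N ∧ IsCyclic (G ⧸ N) := by
  by_cases hcyc : IsCyclic G
  · exact IsCyclic.exists_cyclic_extension
  have hindex := hG.sq_le_index_frattini hcyc
  have hrange : (Set.range fun x : G => x ^ p) = frattini G := by
    refine Set.eq_of_subset_of_ncard_le ?_ ?_
    · rintro _ ⟨x, rfl⟩
      exact hG.pow_mem_frattini x
    · have h1 := (frattini G).card_mul_index
      have h2 : (frattini G : Set G).ncard = Nat.card (frattini G) := rfl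
      rw [h2]
      refine Nat.le_of_mul_le_mul_left ?_ (pow_pos (Fact.out : p.Prime).pos 2)
      calc p ^ 2 * Nat.card (frattini G) ≤ (frattini G).index * Nat.card (frattini G) :=
            Nat.mul_le_mul_right _ hindex
        _ = Nat.card G := by rw [mul_comm, h1]
        _ ≤ _ := hcard
  have hpow : ∀ x ∈ frattini G, ∃ z, z ^ p = x := fun x hx => by
    have : x ∈ (frattini G : Set G) := hx
    rwa [← hrange] at this
  obtain ⟨g, h, hgh, hc⟩ := exists_commutator_le_zpowers (Nat.card G) rfl hG
    (fun x y => hpow _ (mul_mem (hG.pow_mem_frattini x) (hG.pow_mem_frattini y)))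
    (fun x hx => hpow x (hG.commutator_le_frattini hx)) hab
  have hN : (Subgroup.zpowers g).Normal := Subgroup.Normal.of_commutator_le G hc
  refine ⟨Subgroup.zpowers g, hN, inferInstance, ⟨(h : G ⧸ Subgroup.zpowers g), fun y => ?_⟩⟩
  have h1 := closure_pair_quotient_eq_top hgh (Subgroup.zpowers g)
  rw [(QuotientGroup.eq_one_iff g).mpr (Subgroup.mem_zpowers g),
    Subgroup.closure_insert_one, ← Subgroup.zpowers_eq_closure] at h1
  have := Subgroup.mem_top (y : G ⧸ Subgroup.zpowers g)
  rwa [← h1] at this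

section Omega

variable {p : ℕ} [Fact p.Prime] {G : Type*} [Group G] [Finite G]

theorem Set.eq_zpow_mul_zpow_of_ncard_le {x y : G} (hx : orderOf x = p) (hy : orderOf y = p)
    (hxy : y ∉ Subgroup.zpowers x) {S : Set G} (hS : S.ncard ≤ p ^ 2)
    (hmem : ∀ i j : ℤ, x ^ i * y ^ j ∈ S) {s : G} (hs : s ∈ S) :
    ∃ i j : ℤ, s = x ^ i * y ^ j := by
  have hdisj : Disjoint (Subgroup.zpowers x) (Subgroup.zpowers y) := by
    have hp : IsPGroup p (Subgroup.zpowers y) :=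
      IsPGroup.of_card (n := 1) (by rw [Nat.card_zpowers, hy, pow_one])
    rw [Subgroup.disjoint_def]
    intro w hwx hwy
    by_contra hw
    have h1 := (hp.mem_zpowers_or_mem_zpowers_pow (g := ⟨y, Subgroup.mem_zpowers y⟩)
      (x := ⟨w, hwy⟩) (by
        obtain ⟨k, rfl⟩ := hwy
        exact ⟨k, Subtype.ext rfl⟩))
    rcases h1 with ⟨k, hk⟩ | ⟨k, hk⟩
    · refine hxy ?_
      have : y = w ^ k := (congrArg Subtype.val hk).symm
      rw [this]
      exact zpow_mem hwx k
    · refine hw ?_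
      have : (y ^ p) ^ k = w := congrArg Subtype.val hk
      rw [← this, ← hy, pow_orderOf_eq_one, one_zpow]
  have hinj := Subgroup.mul_injective_of_disjoint hdisj
  have hrange : (Set.range fun g : Subgroup.zpowers x × Subgroup.zpowers y => (g.1 : G) * g.2)
      = S := by
    refine Set.eq_of_subset_of_ncard_le ?_ ?_
    · rintro _ ⟨⟨⟨_, i, rfl⟩, ⟨_, j, rfl⟩⟩, rfl⟩
      exact hmem i j
    · rw [← Set.image_univ, Set.ncard_image_of_injective _ hinj, Set.ncard_univ, Nat.card_prod,
        Nat.card_zpowers, Nat.card_zpowers, hx, hy, ← sq]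
      exact hS
  rw [← hrange] at hs
  obtain ⟨⟨⟨_, i, rfl⟩, ⟨_, j, rfl⟩⟩, rfl⟩ := hs
  exact ⟨i, j, rfl⟩

theorem closure_pair_subtype_eq_top {G : Type*} [Group G] (a b : G) :
    Subgroup.closure {(⟨a, Subgroup.subset_closure (by simp)⟩ : Subgroup.closure {a, b}),
      ⟨b, Subgroup.subset_closure (by simp)⟩} = ⊤ := by
  rw [← Subgroup.closure_closure_coe_preimage (k := {a, b})]
  congr 1
  ext ⟨x, hx⟩
  simp

/-- In a finite `p`-group with at most `p ^ 2` elements of order dividing `p`, all such elements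
commute. -/
theorem IsPGroup.commute_of_pow_eq_one (hG : IsPGroup p G) {a b : G}
    (hcard : {w : G | w ^ p = 1}.ncard ≤ p ^ 2)
    (ha : a ^ p = 1) (hb : b ^ p = 1) : Commute a b := by
  by_cases ha1 : a = 1
  · exact ha1 ▸ Commute.one_left b
  have htop : (⊤ : Subgroup G) ≠ ⊥ := fun h => ha1 (by
    have := Subgroup.mem_top a
    rwa [h, Subgroup.mem_bot] at this)
  obtain ⟨z, -, hzp, hz⟩ := hG.exists_central_orderOf_eq ⊤ htop
  by_cases hza : z ∈ Subgroup.zpowers a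
  · rcases hG.mem_zpowers_or_mem_zpowers_pow hza with ⟨k, hk⟩ | h
    · rw [← hk]
      exact ((hz b).zpow_right k).symm
    · rw [ha, Subgroup.zpowers_one_eq_bot, Subgroup.mem_bot] at h
      rw [h, orderOf_one] at hzp
      exact absurd hzp (Fact.out : p.Prime).one_lt.ne
  · have hz1 : z ^ p = 1 := hzp ▸ pow_orderOf_eq_one z
    obtain ⟨i, j, hij⟩ := Set.eq_zpow_mul_zpow_of_ncard_le (orderOf_eq_prime ha ha1) hzp hza hcard
      (fun i j => by
        change _ ^ p = 1
        rw [(((hz a).zpow_left i).zpow_right j).mul_pow, ← zpow_natCast,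
          ← zpow_natCast, zpow_comm, zpow_comm z, zpow_natCast, zpow_natCast, ha, hz1]
        simp) (show b ∈ _ from hb)
    rw [hij]
    exact ((Commute.refl a).zpow_right i).mul_right ((hz a).zpow_right j)

theorem IsPGroup.mul_pow_mem_zpowers_of_closure_eq_top (hG : IsPGroup p G) {g u : G}
    (hgu : Subgroup.closure {g, u} = ⊤) (hcard : {w : G | w ^ p = 1}.ncard ≤ p ^ 2)
    (hcomm : ∀ x y : G, x ^ p = 1 → y ^ p = 1 → Commute x y)
    (hg : g ^ p ≠ 1) (hu : u ^ p = 1) : (g * u) ^ p ∈ Subgroup.zpowers (g ^ p) := by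
  obtain ⟨e, heg, hep⟩ : ∃ e ∈ Subgroup.zpowers (g ^ p), orderOf e = p :=
    ⟨_, Subgroup.npow_mem_zpowers _ _,
      orderOf_pow_orderOf_div (orderOf_pos _).ne' (hG.dvd_orderOf hg)⟩
  have he1 : e ^ p = 1 := hep ▸ pow_orderOf_eq_one e
  have heF : e ∈ frattini G := Subgroup.zpowers_le.mpr (hG.pow_mem_frattini g) heg
  have hec : Commute e g := by
    obtain ⟨k, rfl⟩ := heg
    exact ((Commute.refl g).pow_left p).zpow_left k
  have hecu : Commute e u := hcomm e u he1 hu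
  have hcyc : u ∈ frattini G → u ∈ Subgroup.zpowers g := fun h => by
    have : Subgroup.zpowers g = ⊤ := by
      apply frattini_nongenerating
      rw [eq_top_iff, ← hgu, Subgroup.closure_le]
      rintro x (rfl | rfl)
      · exact Subgroup.mem_sup_left (Subgroup.mem_zpowers _)
      · exact Subgroup.mem_sup_right h
    exact this ▸ Subgroup.mem_top u
  by_cases hug : u ∈ Subgroup.zpowers g
  · obtain ⟨k, rfl⟩ := hug
    rw [((Commute.refl g).zpow_right k).mul_pow, hu, mul_one]
    exact Subgroup.mem_zpowers _
  have hue : u ∉ Subgroup.zpowers e := fun h =>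
    hug (Subgroup.zpowers_le.mpr (Subgroup.zpowers_le.mpr (Subgroup.npow_mem_zpowers g p) heg) h)
  have hu1 : u ≠ 1 := fun h => hug (h ▸ one_mem _)
  have hcomp : ∀ w : G, w ^ p = 1 → ∃ i j : ℤ, w = e ^ i * u ^ j := fun w hw =>
    Set.eq_zpow_mul_zpow_of_ncard_le hep (orderOf_eq_prime hu hu1) hue hcard
      (fun i j => by
        change _ ^ p = 1
        rw [((hecu.zpow_left i).zpow_right j).mul_pow, ← zpow_natCast,
          ← zpow_natCast, zpow_comm, zpow_comm u, zpow_natCast, zpow_natCast, he1, hu]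
        simp) hw
  have hconj : (g⁻¹ * u⁻¹ * g) ^ p = 1 := by
    have := conj_pow (i := p) (a := g⁻¹) (b := u⁻¹)
    rw [inv_inv] at this
    rw [this, inv_pow, hu]
    simp
  obtain ⟨i, j, hij⟩ := hcomp (g⁻¹ * u⁻¹ * g * u) (by
    rw [(hcomm _ u hconj hu).mul_pow, hconj, hu, one_mul])
  have hcomF : g⁻¹ * u⁻¹ * g * u ∈ frattini G := by
    have := Subgroup.commutator_mem_commutator (Subgroup.mem_top g⁻¹) (Subgroup.mem_top u⁻¹)
    rw [commutatorElement_def, inv_inv, inv_inv] at this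
    exact hG.commutator_le_frattini this
  have hj : (p : ℤ) ∣ j := by
    by_contra hj
    refine hug (hcyc (Subgroup.zpowers_le.mpr ?_ (hG.mem_zpowers_zpow u hj)))
    rw [hij] at hcomF
    exact (Subgroup.mul_mem_cancel_left _ (zpow_mem heF i)).mp hcomF
  obtain ⟨l, rfl⟩ := hj
  rw [zpow_mul, zpow_natCast, hu, one_zpow, mul_one] at hij
  have hgu' : g * u = u * g * e ^ i := by
    rw [← hij]
    group
  have hpow : ∀ n : ℕ, ∃ t : ℤ, (g * u) ^ n = u ^ n * g ^ n * e ^ t := by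
    intro n
    induction n with
    | zero => exact ⟨0, by simp⟩
    | succ n ih =>
      obtain ⟨t, ht⟩ := ih
      have hgun : ∀ m : ℕ, ∃ s : ℤ, g ^ m * u = u * g ^ m * e ^ s := by
        intro m
        induction m with
        | zero => exact ⟨0, by simp⟩
        | succ m ihm =>
          obtain ⟨s, hs⟩ := ihm
          refine ⟨i + s, ?_⟩
          have h1 : g * e ^ i = e ^ i * g := ((hec.zpow_left i).eq).symm
          have h2 : e ^ i * g ^ m = g ^ m * e ^ i := (hec.zpow_left i).pow_right m
          calc g ^ (m + 1) * u = g * (g ^ m * u) := by rw [pow_succ', mul_assoc]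
            _ = (g * u) * (g ^ m * e ^ s) := by rw [hs]; group
            _ = u * g * (e ^ i * g ^ m) * e ^ s := by rw [hgu']; group
            _ = u * g ^ (m + 1) * e ^ (i + s) := by rw [h2, pow_succ', zpow_add]; group
      obtain ⟨s, hs⟩ := hgun (n + 1)
      refine ⟨s + t, ?_⟩
      have h3 : e ^ t * (g * u) = (g * u) * e ^ t := (hec.mul_right hecu).zpow_left t
      calc (g * u) ^ (n + 1) = u ^ n * g ^ n * (e ^ t * (g * u)) := by
            rw [pow_succ, ht, mul_assoc]
        _ = u ^ n * (g ^ (n + 1) * u) * e ^ t := by rw [h3, pow_succ g]; simp only [mul_assoc]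
        _ = u ^ (n + 1) * g ^ (n + 1) * e ^ (s + t) := by
            rw [hs, pow_succ u, zpow_add]; simp only [mul_assoc]
  obtain ⟨t, ht⟩ := hpow p
  rw [ht, hu, one_mul]
  exact mul_mem (Subgroup.mem_zpowers _) (zpow_mem heg t)

end Omega

theorem ncard_subtype_pow_eq_one {G : Type*} [Group G] (H : Subgroup G) (n : ℕ) :
    {w : H | w ^ n = 1}.ncard = {w : G | w ∈ H ∧ w ^ n = 1}.ncard := by
  rw [← Set.ncard_image_of_injective _ Subtype.val_injective]
  congr 1
  ext w
  constructor
  · rintro ⟨v, hv, rfl⟩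
    exact ⟨v.2, congrArg Subtype.val hv⟩
  · rintro ⟨hw, hw'⟩
    exact ⟨⟨w, hw⟩, Subtype.ext hw', rfl⟩

theorem ncard_zpowers {G : Type*} [Group G] (x : G) :
    (Subgroup.zpowers x : Set G).ncard = orderOf x :=
  Nat.card_zpowers x

theorem orderOf_pow_prime {p : ℕ} [Fact p.Prime] {G : Type*} [Group G] [Finite G]
    (hG : IsPGroup p G) {g : G} (hg : g ≠ 1) : orderOf (g ^ p) * p = orderOf g := by
  have h := hG.dvd_orderOf hg
  rw [orderOf_pow_of_dvd (Fact.out : p.Prime).ne_zero h, Nat.div_mul_cancel h]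

section Abelian

variable {p : ℕ} [Fact p.Prime] {G : Type*} [CommGroup G] [Finite G]

theorem ncard_pow_eq_one_eq_index (n : ℕ) :
    {w : G | w ^ n = 1}.ncard = (powMonoidHom n : G →* G).range.index := by
  have h1 := (powMonoidHom n : G →* G).ker.card_mul_index
  have h2 := (powMonoidHom n : G →* G).range.card_mul_index
  rw [Subgroup.index_ker] at h1
  have h3 : {w : G | w ^ n = 1}.ncard = Nat.card (powMonoidHom n : G →* G).ker := rfl
  rw [h3]
  refine Nat.eq_of_mul_eq_mul_left (Nat.card_pos (α := (powMonoidHom n : G →* G).range)) ?_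
  rw [h2, ← h1, mul_comm]

theorem ncard_pow_eq_one_le {g h : G} (hgh : Subgroup.closure {g, h} = ⊤) :
    {w : G | w ^ p = 1}.ncard ≤ p ^ 2 := by
  rw [ncard_pow_eq_one_eq_index, Subgroup.index_eq_card]
  set N := (powMonoidHom p : G →* G).range
  have htop := closure_pair_quotient_eq_top hgh N
  have hcard : ∀ x : G, Nat.card (Subgroup.zpowers (x : G ⧸ N)) ≤ p := fun x => by
    rw [Nat.card_zpowers]
    refine orderOf_le_of_pow_eq_one (Fact.out : p.Prime).pos ?_
    rw [← QuotientGroup.mk_pow, QuotientGroup.eq_one_iff]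
    exact ⟨x, rfl⟩
  have hsurj : Function.Surjective
      fun w : Subgroup.zpowers (g : G ⧸ N) × Subgroup.zpowers (h : G ⧸ N) =>
        (w.1 : G ⧸ N) * w.2 := fun x => by
    have hx := Subgroup.mem_top x
    rw [← htop, Subgroup.mem_closure_pair] at hx
    obtain ⟨m, n, rfl⟩ := hx
    exact ⟨⟨⟨_, m, rfl⟩, ⟨_, n, rfl⟩⟩, rfl⟩
  calc Nat.card (G ⧸ N) ≤ _ := Nat.card_le_card_of_surjective _ hsurj
    _ ≤ p * p := by
      rw [Nat.card_prod]
      exact Nat.mul_le_mul (hcard g) (hcard h)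
    _ = p ^ 2 := (sq p).symm

theorem ncard_closure_pair_pow_eq_one_le (x y : G) :
    {w : G | w ∈ Subgroup.closure {x, y} ∧ w ^ p = 1}.ncard ≤ p ^ 2 := by
  rw [← ncard_subtype_pow_eq_one]
  exact ncard_pow_eq_one_le (closure_pair_subtype_eq_top x y)

theorem IsPGroup.sq_le_ncard_pow_eq_one (hG : IsPGroup p G) (hcyc : ¬ IsCyclic G) :
    p ^ 2 ≤ {w : G | w ^ p = 1}.ncard := by
  refine (hG.sq_le_index_frattini hcyc).trans ?_
  rw [ncard_pow_eq_one_eq_index]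
  refine Nat.le_of_dvd (Nat.pos_of_ne_zero Subgroup.index_ne_zero_of_finite)
    (Subgroup.index_dvd_of_le ?_)
  rintro _ ⟨x, rfl⟩
  exact hG.pow_mem_frattini x

theorem IsPGroup.exists_pow_eq_one_notMem_zpowers (hG : IsPGroup p G) (hcyc : ¬ IsCyclic G)
    (x : G) : ∃ u : G, u ^ p = 1 ∧ u ∉ Subgroup.zpowers x := by
  by_contra! h
  have h1 := hG.sq_le_ncard_pow_eq_one hcyc
  have h2 : {w : G | w ^ p = 1} = {w : G | w ∈ Subgroup.zpowers x ∧ w ^ p = 1} :=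
    Set.ext fun w => ⟨fun hw => ⟨h w hw, hw⟩, fun hw => hw.2⟩
  classical
  have := Fintype.ofFinite (Subgroup.zpowers x)
  have h3 := IsCyclic.card_pow_eq_one_le (α := Subgroup.zpowers x) (Fact.out : p.Prime).pos
  rw [h2, ← ncard_subtype_pow_eq_one, Set.ncard_eq_toFinset_card'] at h1
  simp only [Set.toFinset_ofPred] at h1
  have := (Fact.out : p.Prime).one_lt
  nlinarith

/-- In a noncyclic finite abelian `p`-group, `x` is a power of `y` as soon as every element
comparable with `y` is comparable with `x`. -/
theorem IsPGroup.mem_zpowers_of_comparable (hG : IsPGroup p G) (hcyc : ¬ IsCyclic G) {x y : G}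
    (h : ∀ z, z ∈ Subgroup.zpowers y ∨ y ∈ Subgroup.zpowers z →
      z ∈ Subgroup.zpowers x ∨ x ∈ Subgroup.zpowers z) : x ∈ Subgroup.zpowers y := by
  by_contra hxy
  have hyx := (h y (Or.inl (Subgroup.mem_zpowers y))).resolve_right hxy
  have hyxp := (hG.mem_zpowers_or_mem_zpowers_pow hyx).resolve_left hxy
  obtain ⟨u, hu, hux⟩ := hG.exists_pow_eq_one_notMem_zpowers hcyc x
  have hw : (x * u) ^ p = x ^ p := by rw [mul_pow, hu, mul_one]
  have hwx : x * u ∉ Subgroup.zpowers x := fun hw =>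
    hux ((Subgroup.mul_mem_cancel_left _ (Subgroup.mem_zpowers x)).mp hw)
  have hyw : y ∈ Subgroup.zpowers (x * u) := by
    rw [← hw] at hyxp
    exact Subgroup.zpowers_le.mpr (Subgroup.npow_mem_zpowers _ p) hyxp
  have hxw := (h _ (Or.inr hyw)).resolve_left hwx
  have := (hG.mem_zpowers_or_mem_zpowers_pow hxw).resolve_left hwx
  rw [hw] at this
  exact hxy (hG.eq_one_of_mem_zpowers_pow this ▸ one_mem _)

end Abelian

section Comparability

variable {p : ℕ} [Fact p.Prime] {G₁ G₂ : Type*} [CommGroup G₁] [Finite G₁] [Group G₂] [Finite G₂]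

/-- A bijection from a noncyclic finite abelian `p`-group to a `p`-group which preserves
comparability in the power preorder preserves the power preorder. -/
theorem mem_zpowers_iff_of_comparable_iff (h₁ : IsPGroup p G₁) (h₂ : IsPGroup p G₂)
    (hcyc : ¬ IsCyclic G₁) (φ : G₁ ≃ G₂)
    (hφ : ∀ x y, (x ∈ Subgroup.zpowers y ∨ y ∈ Subgroup.zpowers x) ↔
      (φ x ∈ Subgroup.zpowers (φ y) ∨ φ y ∈ Subgroup.zpowers (φ x))) (x y : G₁) :
    x ∈ Subgroup.zpowers y ↔ φ x ∈ Subgroup.zpowers (φ y) := by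
  have hback : ∀ {x y}, φ x ∈ Subgroup.zpowers (φ y) → x ∈ Subgroup.zpowers y := by
    refine fun {x y} hxy => h₁.mem_zpowers_of_comparable hcyc fun z hz => (hφ z x).mpr ?_
    rcases (hφ z y).mp hz with hz | hz
    · exact h₂.mem_zpowers_total hz hxy
    · exact Or.inr (Subgroup.zpowers_le.mpr hz hxy)
  have hlt : ∀ {x y}, x ∈ Subgroup.zpowers y → y ∉ Subgroup.zpowers x →
      φ x ∈ Subgroup.zpowers (φ y) := fun {x y} hxy hyx =>
    ((hφ x y).mp (Or.inl hxy)).resolve_right fun h => hyx (hback h)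
  refine ⟨fun hxy => ?_, hback⟩
  by_cases hyx : y ∈ Subgroup.zpowers x
  swap
  · exact hlt hxy hyx
  obtain ⟨c, hc, hmax⟩ := Set.exists_max_image (Subgroup.zpowers y : Set G₁)
    (fun z => orderOf (φ z)) (Set.toFinite _) ⟨y, Subgroup.mem_zpowers y⟩
  have hle : ∀ z ∈ Subgroup.zpowers y, φ z ∈ Subgroup.zpowers (φ c) := fun z hz => by
    rcases (hφ z c).mp (h₁.mem_zpowers_total hz hc) with h | h
    · exact h
    · have h1 := Subgroup.eq_of_le_of_card_ge (Subgroup.zpowers_le.mpr h)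
        (by rw [Nat.card_zpowers, Nat.card_zpowers]; exact hmax z hz)
      rw [h1]
      exact Subgroup.mem_zpowers _
  have hyc : y ∈ Subgroup.zpowers c := hback (hle y (Subgroup.mem_zpowers y))
  have heq : Subgroup.zpowers c = Subgroup.zpowers y :=
    le_antisymm (Subgroup.zpowers_le.mpr hc) (Subgroup.zpowers_le.mpr hyc)
  have himage : φ '' (Subgroup.zpowers c) = Subgroup.zpowers (φ c) := by
    refine Set.Subset.antisymm ?_ fun b hb => ⟨φ.symm b, hback ?_, φ.apply_symm_apply b⟩
    · rintro _ ⟨z, hz, rfl⟩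
      exact hle z (heq ▸ hz)
    · rwa [φ.apply_symm_apply]
  have hcard : orderOf c = orderOf (φ c) := by
    rw [← ncard_zpowers, ← ncard_zpowers, ← himage, Set.ncard_image_of_injective _ φ.injective]
  by_cases hc1 : c = 1
  · rw [← heq, hc1, Subgroup.zpowers_one_eq_bot, Subgroup.mem_bot] at hxy
    rw [hc1, Subgroup.zpowers_one_eq_bot, Subgroup.mem_bot] at hyc
    rw [hxy, hyc]
    exact Subgroup.mem_zpowers _
  have hφc1 : φ c ≠ 1 := fun h => hc1 (by rwa [h, orderOf_one, orderOf_eq_one_iff] at hcard)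
  have himage' : φ '' (Subgroup.zpowers (c ^ p)) = Subgroup.zpowers (φ c ^ p) := by
    refine Set.eq_of_subset_of_ncard_le ?_ ?_
    · rintro _ ⟨w, hw, rfl⟩
      have hwc := Subgroup.zpowers_le.mpr (Subgroup.npow_mem_zpowers c p) hw
      refine (h₂.mem_zpowers_or_mem_zpowers_pow (hle w (heq ▸ hwc))).resolve_left fun h =>
        hc1 (h₁.eq_one_of_mem_zpowers_pow (Subgroup.zpowers_le.mpr hw (hback h)))
    · rw [Set.ncard_image_of_injective _ φ.injective, ncard_zpowers, ncard_zpowers]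
      refine (Nat.eq_of_mul_eq_mul_right (Fact.out : p.Prime).pos ?_).le
      rw [orderOf_pow_prime h₁ hc1, orderOf_pow_prime h₂ hφc1, hcard]
  have hcy : φ c ∈ Subgroup.zpowers (φ y) := by
    refine (h₂.mem_zpowers_or_mem_zpowers_pow
      (hle y (Subgroup.mem_zpowers y))).resolve_right fun h => ?_
    have h2 : φ y ∈ (Subgroup.zpowers (φ c ^ p) : Set G₂) := h
    rw [← himage'] at h2
    obtain ⟨w, hw, hwy⟩ := h2
    rw [φ.injective hwy] at hw
    exact hc1 (h₁.eq_one_of_mem_zpowers_pow (Subgroup.zpowers_le.mpr hw hc))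
  exact Subgroup.zpowers_le.mpr hcy (hle x hxy)

end Comparability

section Rank

variable {G : Type*} [Group G]

theorem dgen_le [Finite G] {S : Set G} {H : Subgroup G} (h : Subgroup.closure S = H) :
    dgen H ≤ S.ncard :=
  Nat.sInf_le ⟨S, Set.toFinite S, h ▸ Subgroup.subset_closure, h, rfl⟩

theorem exists_ncard_eq_dgen [Finite G] (H : Subgroup G) :
    ∃ S : Set G, Subgroup.closure S = H ∧ S.ncard = dgen H := by
  have h := Nat.sInf_mem (s := {n : ℕ | ∃ S : Set G, S.Finite ∧ S ⊆ (H : Set G) ∧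
    Subgroup.closure S = H ∧ S.ncard = n})
    ⟨_, H, Set.toFinite _, subset_rfl, Subgroup.closure_eq H, rfl⟩
  obtain ⟨S, -, -, hS, hn⟩ := h
  exact ⟨S, hS, hn⟩

theorem exists_eq_zpowers_of_dgen_le_one [Finite G] {H : Subgroup G} (h : dgen H ≤ 1) :
    ∃ g, H = Subgroup.zpowers g := by
  obtain ⟨S, rfl, hn⟩ := exists_ncard_eq_dgen H
  rcases (Set.ncard_le_one_iff_eq (Set.toFinite S)).mp (hn.trans_le h) with rfl | ⟨a, rfl⟩
  · exact ⟨1, by simp⟩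
  · exact ⟨a, (Subgroup.zpowers_eq_closure a).symm⟩

theorem exists_eq_closure_pair_of_dgen_le_two [Finite G] {H : Subgroup G} (h : dgen H ≤ 2) :
    ∃ a b, H = Subgroup.closure {a, b} := by
  rcases h.eq_or_lt with h2 | h1
  · obtain ⟨S, rfl, hn⟩ := exists_ncard_eq_dgen H
    obtain ⟨a, b, -, rfl⟩ := Set.ncard_eq_two.mp (hn.trans h2)
    exact ⟨a, b, rfl⟩
  · obtain ⟨g, rfl⟩ := exists_eq_zpowers_of_dgen_le_one (Nat.le_of_lt_succ h1)
    exact ⟨g, g, by rw [Set.pair_eq_singleton, Subgroup.zpowers_eq_closure]⟩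

theorem closure_pair_eq_zpowers {x y : G} (h : x ∈ Subgroup.zpowers y) :
    Subgroup.closure {x, y} = Subgroup.zpowers y :=
  le_antisymm ((Subgroup.closure_le _).mpr (Set.pair_subset h (Subgroup.mem_zpowers y)))
    (Subgroup.zpowers_le.mpr (Subgroup.subset_closure (by simp)))

theorem independent_pair_iff {x y : G} (hxy : x ≠ y) :
    Independent {x, y} ↔ ¬ (x ∈ Subgroup.zpowers y ∨ y ∈ Subgroup.zpowers x) := by
  have h1 : ({x, y} : Set G) \ {x} = {y} := by grind
  have h2 : ({x, y} : Set G) \ {y} = {x} := by grind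
  rw [Independent, Set.forall_mem_insert]
  simp only [Set.mem_singleton_iff, forall_eq]
  rw [h1, h2, ← Subgroup.zpowers_eq_closure, ← Subgroup.zpowers_eq_closure, not_or]

theorem stronglyIndependent_pair_iff [Finite G] {p : ℕ} [Fact p.Prime] (hG : IsPGroup p G)
    {x y : G} (hxy : x ≠ y) :
    StronglyIndependent {x, y} ↔ ¬ (x ∈ Subgroup.zpowers y ∨ y ∈ Subgroup.zpowers x) := by
  have hle : ∀ g : G, dgen (Subgroup.zpowers g) ≤ 1 := fun g =>
    (dgen_le (S := {g}) (Subgroup.zpowers_eq_closure g).symm).trans_eq (Set.ncard_singleton g)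
  rw [StronglyIndependent, Set.ncard_pair hxy]
  constructor
  · rintro h (hx | hy)
    · have := (h (Subgroup.zpowers y) (Set.pair_subset hx (Subgroup.mem_zpowers y))).trans (hle y)
      omega
    · have := (h (Subgroup.zpowers x) (Set.pair_subset (Subgroup.mem_zpowers x) hy)).trans (hle x)
      omega
  · intro h H hH
    by_contra! hlt
    obtain ⟨g, rfl⟩ := exists_eq_zpowers_of_dgen_le_one (Nat.le_of_lt_succ hlt)
    exact h (hG.mem_zpowers_total (hH (by simp)) (hH (by simp)))

end Rank

section Triple

variable {p : ℕ} [Fact p.Prime] {G : Type*} [CommGroup G]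

theorem IsPGroup.notMem_closure_pair (hG : IsPGroup p G) {x y t : G}
    (hxy : x ∉ Subgroup.zpowers y) (ht : t ^ p = 1) (htxy : t ∉ Subgroup.closure {x, y}) :
    x ∉ Subgroup.closure {y, t} := by
  intro hx
  obtain ⟨m, n, rfl⟩ := Subgroup.mem_closure_pair.mp hx
  by_cases hn : (p : ℤ) ∣ n
  · obtain ⟨k, rfl⟩ := hn
    rw [zpow_mul, zpow_natCast, ht, one_zpow, mul_one] at hxy
    exact hxy (Subgroup.zpow_mem_zpowers y m)
  · refine htxy (Subgroup.zpowers_le.mpr ?_ (hG.mem_zpowers_zpow t hn))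
    have h1 : y ^ m * t ^ n ∈ Subgroup.closure {y ^ m * t ^ n, y} :=
      Subgroup.subset_closure (by simp)
    have h2 : y ∈ Subgroup.closure {y ^ m * t ^ n, y} := Subgroup.subset_closure (by simp)
    exact (Subgroup.mul_mem_cancel_left _ (zpow_mem h2 m)).mp h1

theorem IsPGroup.independent_triple (hG : IsPGroup p G) {x y t : G}
    (hxy : x ∉ Subgroup.zpowers y) (hyx : y ∉ Subgroup.zpowers x) (ht : t ^ p = 1)
    (htxy : t ∉ Subgroup.closure {x, y}) : Independent {x, y, t} := by
  have hx := hG.notMem_closure_pair hxy ht htxy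
  have hy := hG.notMem_closure_pair hyx ht (by rwa [Set.pair_comm])
  have hne : ∀ {g a b : G}, g ∉ Subgroup.closure {a, b} → ({g, a, b} : Set G) \ {g} = {a, b} :=
    fun {g a b} h => Set.insert_sdiff_self_of_notMem fun hg => h (Subgroup.subset_closure hg)
  rintro g (rfl | rfl | rfl)
  · rwa [hne hx]
  · rwa [Set.insert_comm, hne hy]
  · have : ({x, y, g} : Set G) = {g, x, y} := by grind
    rwa [this, hne htxy]

theorem IsPGroup.stronglyIndependent_triple [Finite G] (hG : IsPGroup p G) {x y t : G}
    (hxy : x ∉ Subgroup.zpowers y) (hyx : y ∉ Subgroup.zpowers x) (ht : t ^ p = 1)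
    (htxy : t ∉ Subgroup.closure {x, y}) : StronglyIndependent {x, y, t} := by
  intro H hH
  by_contra! hlt
  have h3 := Set.ncard_insert_le x {y, t}
  have h4 := Set.ncard_insert_le y {t}
  rw [Set.ncard_singleton] at h4
  obtain ⟨a, b, rfl⟩ := exists_eq_closure_pair_of_dgen_le_two (H := H) (by omega)
  have hcyc : ¬ IsCyclic (Subgroup.closure {x, y}) := fun h => by
    obtain ⟨g, hg⟩ := (Subgroup.isCyclic_iff_exists_zpowers_eq_top _).mp h
    have hx : x ∈ Subgroup.zpowers g := hg ▸ Subgroup.subset_closure (by simp)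
    have hy : y ∈ Subgroup.zpowers g := hg ▸ Subgroup.subset_closure (by simp)
    exact (hG.mem_zpowers_total hx hy).elim hxy hyx
  have h1 := (hG.to_subgroup (Subgroup.closure {x, y})).sq_le_ncard_pow_eq_one hcyc
  rw [ncard_subtype_pow_eq_one] at h1
  have h2 : {w : G | w ∈ Subgroup.closure {x, y} ∧ w ^ p = 1} =
      {w : G | w ∈ Subgroup.closure {a, b} ∧ w ^ p = 1} :=
    Set.eq_of_subset_of_ncard_le
      (fun w hw => ⟨(Subgroup.closure_le _).mpr
        (Set.pair_subset (hH (by simp)) (hH (by simp))) hw.1, hw.2⟩)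
      ((ncard_closure_pair_pow_eq_one_le a b).trans h1)
  have h5 : t ∈ {w : G | w ∈ Subgroup.closure {a, b} ∧ w ^ p = 1} := ⟨hH (by simp), ht⟩
  rw [← h2] at h5
  exact htxy h5.1

end Triple

section Transfer

variable {p : ℕ} [Fact p.Prime] {G₁ G₂ : Type*} [CommGroup G₁] [Finite G₁] [Group G₂] [Finite G₂]

theorem comparable_iff_of_independent_iff (h₁ : IsPGroup p G₁) (h₂ : IsPGroup p G₂) (φ : G₁ ≃ G₂)
    (h : (∀ X : Set G₁, Independent X ↔ Independent (φ '' X)) ∨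
      ∀ X : Set G₁, StronglyIndependent X ↔ StronglyIndependent (φ '' X)) (x y : G₁) :
    (x ∈ Subgroup.zpowers y ∨ y ∈ Subgroup.zpowers x) ↔
      (φ x ∈ Subgroup.zpowers (φ y) ∨ φ y ∈ Subgroup.zpowers (φ x)) := by
  by_cases hxy : x = y
  · subst hxy
    simp
  have hφ := φ.injective.ne hxy
  rw [← not_iff_not]
  rcases h with h | h
  · rw [← independent_pair_iff hxy, ← independent_pair_iff hφ, h, Set.image_pair]
  · rw [← stronglyIndependent_pair_iff h₁ hxy, ← stronglyIndependent_pair_iff h₂ hφ, h,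
      Set.image_pair]

theorem notMem_closure_pair_of_independent_iff (h₁ : IsPGroup p G₁) (φ : G₁ ≃ G₂)
    (h : (∀ X : Set G₁, Independent X ↔ Independent (φ '' X)) ∨
      ∀ X : Set G₁, StronglyIndependent X ↔ StronglyIndependent (φ '' X))
    (hφ : ∀ x y, x ∈ Subgroup.zpowers y ↔ φ x ∈ Subgroup.zpowers (φ y)) {t x y : G₁}
    (ht : t ^ p = 1) (htxy : t ∉ Subgroup.closure {x, y}) :
    φ t ∉ Subgroup.closure {φ x, φ y} := by
  by_cases hxy : x ∈ Subgroup.zpowers y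
  · rw [closure_pair_eq_zpowers hxy] at htxy
    rw [closure_pair_eq_zpowers ((hφ x y).mp hxy)]
    exact fun hmem => htxy ((hφ t y).mpr hmem)
  by_cases hyx : y ∈ Subgroup.zpowers x
  · rw [Set.pair_comm, closure_pair_eq_zpowers hyx] at htxy
    rw [Set.pair_comm, closure_pair_eq_zpowers ((hφ y x).mp hyx)]
    exact fun hmem => htxy ((hφ t x).mpr hmem)
  have htx : t ≠ x := fun h => htxy (h ▸ Subgroup.subset_closure (by simp))
  have hty : t ≠ y := fun h => htxy (h ▸ Subgroup.subset_closure (by simp))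
  have hne : x ≠ y := fun h => hxy (h ▸ Subgroup.mem_zpowers x)
  have himage : φ '' {x, y, t} = {φ x, φ y, φ t} := by
    rw [Set.image_insert_eq, Set.image_pair]
  rcases h with h | h
  · have h3 := (h _).mp (h₁.independent_triple hxy hyx ht htxy) (φ t) (by simp)
    have h4 : ({φ x, φ y, φ t} : Set G₂) \ {φ t} = {φ x, φ y} := by
      have := φ.injective.ne htx
      have := φ.injective.ne hty
      grind
    rwa [himage, h4] at h3
  · intro hmem
    have h3 := (h _).mp (h₁.stronglyIndependent_triple hxy hyx ht htxy)
      (Subgroup.closure {φ x, φ y}) (by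
        rw [himage]
        rintro _ (rfl | rfl | rfl)
        exacts [Subgroup.subset_closure (by simp), Subgroup.subset_closure (by simp), hmem])
    rw [Set.ncard_image_of_injective _ φ.injective,
      Set.ncard_eq_three.mpr ⟨x, y, t, hne, htx.symm, hty.symm, rfl⟩] at h3
    have h4 := dgen_le (S := {φ x, φ y}) rfl
    have h5 := Set.ncard_insert_le (φ x) {φ y}
    rw [Set.ncard_singleton] at h5
    omega

end Transfer

theorem exists_normal_subgroup_mem_iff_pow_eq_one {p : ℕ} {G : Type*} [Group G]
    (hcomm : ∀ x y : G, x ^ p = 1 → y ^ p = 1 → Commute x y) :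
    ∃ W : Subgroup G, W.Normal ∧ ∀ w, w ∈ W ↔ w ^ p = 1 :=
  ⟨{ carrier := {w | w ^ p = 1}
     mul_mem' := fun {x y} hx hy => by
      change (x * y) ^ p = 1
      rw [(hcomm x y hx hy).mul_pow, show x ^ p = 1 from hx, show y ^ p = 1 from hy, one_mul]
     one_mem' := one_pow p
     inv_mem' := fun {x} hx => by
      change x⁻¹ ^ p = 1
      rw [inv_pow, show x ^ p = 1 from hx, inv_one] },
   ⟨fun x hx g => by
      change (g * x * g⁻¹) ^ p = 1
      rw [conj_pow, show x ^ p = 1 from hx, mul_one, mul_inv_cancel]⟩,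
   fun _ => Iff.rfl⟩

theorem ncard_zpow_mul_pow_eq_one {p : ℕ} {G : Type*} [Group G]
    (hcomm : ∀ x y : G, x ^ p = 1 → y ^ p = 1 → Commute x y) (b : G) :
    {x : G | ∃ k : ℤ, (b ^ k * x) ^ p = 1}.ncard =
      {w : G | w ^ p = 1}.ncard * orderOf (b ^ p) := by
  obtain ⟨W, hW, hmem⟩ := exists_normal_subgroup_mem_iff_pow_eq_one hcomm
  have h1 : {w : G | w ^ p = 1} = W := Set.ext fun w => (hmem w).symm
  have h2 : {x : G | ∃ k : ℤ, (b ^ k * x) ^ p = 1} = (Subgroup.zpowers b ⊔ W : Subgroup G) := by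
    ext x
    rw [SetLike.mem_coe, Subgroup.mem_sup_of_normal_right]
    constructor
    · rintro ⟨k, hk⟩
      exact ⟨b ^ (-k), ⟨-k, rfl⟩, _, (hmem _).mpr hk, by group⟩
    · rintro ⟨_, ⟨k, rfl⟩, w, hw, rfl⟩
      refine ⟨-k, (hmem _).mp ?_⟩
      simpa using hw
  have h3 : orderOf (b : G ⧸ W) = orderOf (b ^ p) := orderOf_eq_orderOf_iff.mpr fun n => by
    rw [← QuotientGroup.mk_pow, QuotientGroup.eq_one_iff, hmem, ← pow_mul, ← pow_mul, mul_comm]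
  have h4 : W.relIndex (Subgroup.zpowers b) = orderOf (b ^ p) := by
    have := Subgroup.relIndex_ker (Subgroup.zpowers b) (QuotientGroup.mk' W)
    rw [QuotientGroup.ker_mk', MonoidHom.map_zpowers, Nat.card_zpowers] at this
    rw [this, ← h3]
    rfl
  have h5 := Subgroup.relIndex_mul_relIndex ⊥ W (Subgroup.zpowers b ⊔ W) bot_le le_sup_right
  rw [Subgroup.relIndex_bot_left, Subgroup.relIndex_bot_left, Subgroup.relIndex_sup_right] at h5
  rw [h1, h2, ← h4]
  exact h5.symm

section OmegaBound

variable {p : ℕ} [Fact p.Prime] {G : Type*} [Group G] [Finite G]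

theorem IsPGroup.commute_of_ncard_closure_pair_le (hG : IsPGroup p G)
    (hQ : ∀ a b : G, {w : G | w ∈ Subgroup.closure {a, b} ∧ w ^ p = 1}.ncard ≤ p ^ 2) {a b : G}
    (ha : a ^ p = 1) (hb : b ^ p = 1) : Commute a b := by
  have h := (hG.to_subgroup (Subgroup.closure {a, b})).commute_of_pow_eq_one
    (a := ⟨a, Subgroup.subset_closure (by simp)⟩) (b := ⟨b, Subgroup.subset_closure (by simp)⟩)
    (by rw [ncard_subtype_pow_eq_one]; exact hQ a b) (Subtype.ext ha) (Subtype.ext hb)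
  exact congrArg Subtype.val h.eq

theorem IsPGroup.mul_pow_mem_zpowers (hG : IsPGroup p G)
    (hQ : ∀ a b : G, {w : G | w ∈ Subgroup.closure {a, b} ∧ w ^ p = 1}.ncard ≤ p ^ 2) {g u : G}
    (hu : u ^ p = 1) : (g * u) ^ p ∈ Subgroup.zpowers (g ^ p) := by
  by_cases hg : g ^ p = 1
  · rw [(hG.commute_of_ncard_closure_pair_le hQ hg hu).mul_pow, hg, hu, one_mul]
    exact one_mem _
  obtain ⟨k, hk⟩ := (hG.to_subgroup (Subgroup.closure {g, u})).mul_pow_mem_zpowers_of_closure_eq_top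
    (closure_pair_subtype_eq_top g u)
    (by rw [ncard_subtype_pow_eq_one]; exact hQ g u)
    (fun x y hx hy => Subtype.ext (hG.commute_of_ncard_closure_pair_le hQ
      (congrArg Subtype.val hx) (congrArg Subtype.val hy)))
    (fun h => hg (congrArg Subtype.val h)) (Subtype.ext hu)
  exact ⟨k, congrArg Subtype.val hk⟩

/-- If `x ^ p ∈ ⟨b ^ p⟩` exactly when `x` is a power of `b` times an element of order dividing `p`,
then the number of `p`-th powers is at least the order of the group divided by `p ^ 2`. -/
theorem IsPGroup.card_le_of_pow_mem_zpowers_pow_iff (hG : IsPGroup p G)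
    (hcomm : ∀ x y : G, x ^ p = 1 → y ^ p = 1 → Commute x y)
    (hR : ∀ b x : G, x ^ p ∈ Subgroup.zpowers (b ^ p) ↔ ∃ k : ℤ, (b ^ k * x) ^ p = 1)
    (hcard : {w : G | w ^ p = 1}.ncard ≤ p ^ 2) :
    Nat.card G ≤ p ^ 2 * (Set.range fun x : G => x ^ p).ncard := by
  classical
  have := Fintype.ofFinite G
  have hB : ∀ b : G, {x : G | x ^ p ∈ Subgroup.zpowers (b ^ p)}.ncard =
      {w : G | w ^ p = 1}.ncard * orderOf (b ^ p) := fun b => by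
    rw [← ncard_zpow_mul_pow_eq_one hcomm b]
    exact congrArg Set.ncard (Set.ext fun x => hR b x)
  have heq : ∀ {c x : G}, c ≠ 1 → (Subgroup.zpowers x = Subgroup.zpowers c ↔
      x ∈ Subgroup.zpowers c ∧ x ∉ Subgroup.zpowers (c ^ p)) := fun {c x} hc => by
    constructor
    · intro h
      refine ⟨h ▸ Subgroup.mem_zpowers x, fun hx => hc (hG.eq_one_of_mem_zpowers_pow
        (Subgroup.zpowers_le.mpr hx (h ▸ Subgroup.mem_zpowers c)))⟩
    · rintro ⟨h1, h2⟩
      exact le_antisymm (Subgroup.zpowers_le.mpr h1) (Subgroup.zpowers_le.mpr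
        ((hG.mem_zpowers_or_mem_zpowers_pow h1).resolve_right h2))
  have hfib : ∀ b : G, {x : G | Subgroup.zpowers (x ^ p) = Subgroup.zpowers (b ^ p)}.ncard ≤
      p ^ 2 * {v : G | v ∈ (Set.range fun x : G => x ^ p) ∧
        Subgroup.zpowers v = Subgroup.zpowers (b ^ p)}.ncard := fun b => by
    by_cases hb : b ^ p = 1
    · have h1 : {x : G | Subgroup.zpowers (x ^ p) = Subgroup.zpowers (b ^ p)} =
          {w : G | w ^ p = 1} := by
        ext x
        simp [hb]
      have h2 : 1 ≤ {v : G | v ∈ (Set.range fun x : G => x ^ p) ∧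
          Subgroup.zpowers v = Subgroup.zpowers (b ^ p)}.ncard :=
        (Set.ncard_pos (Set.toFinite _)).mpr ⟨b ^ p, ⟨b, rfl⟩, rfl⟩
      rw [h1]
      nlinarith
    · have h1 : {x : G | Subgroup.zpowers (x ^ p) = Subgroup.zpowers (b ^ p)} =
          {x : G | x ^ p ∈ Subgroup.zpowers (b ^ p)} \
            {x : G | x ^ p ∈ Subgroup.zpowers ((b ^ p) ^ p)} := Set.ext fun x => heq hb
      have h2 : {v : G | v ∈ (Set.range fun x : G => x ^ p) ∧
          Subgroup.zpowers v = Subgroup.zpowers (b ^ p)} =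
          (Subgroup.zpowers (b ^ p) : Set G) \ Subgroup.zpowers ((b ^ p) ^ p) := by
        ext v
        refine ⟨fun hv => (heq hb).mp hv.2, fun hv => ⟨?_, (heq hb).mpr hv⟩⟩
        obtain ⟨k, rfl⟩ := hv.1
        refine ⟨b ^ k, ?_⟩
        simp only [← zpow_natCast, ← zpow_mul, mul_comm]
      have h3 : Subgroup.zpowers ((b ^ p) ^ p) ≤ Subgroup.zpowers (b ^ p) :=
        (hG.zpowers_pow_lt hb).le
      have h4 : {x : G | x ^ p ∈ Subgroup.zpowers ((b ^ p) ^ p)} ⊆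
          {x : G | x ^ p ∈ Subgroup.zpowers (b ^ p)} := fun x hx => h3 hx
      rw [h1, h2, Set.ncard_sdiff h4, Set.ncard_sdiff (SetLike.coe_subset_coe.mpr h3), hB, hB,
        ncard_zpowers, ncard_zpowers, ← Nat.mul_sub]
      exact Nat.mul_le_mul_right _ hcard
  set R : Finset G := Finset.univ.image fun x : G => x ^ p
  have hRc : (Set.range fun x : G => x ^ p).ncard = R.card := by
    rw [← Set.ncard_coe_finset]
    simp [R]
  set T : Finset (Subgroup G) := R.image Subgroup.zpowers
  have hT : ∀ v ∈ R, Subgroup.zpowers v ∈ T := fun v hv => Finset.mem_image_of_mem _ hv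
  rw [hRc, Nat.card_eq_fintype_card, ← Finset.card_univ,
    Finset.card_eq_sum_card_fiberwise (f := fun x : G => Subgroup.zpowers (x ^ p)) (t := T)
      (fun x _ => hT _ (Finset.mem_image_of_mem _ (Finset.mem_univ x))),
    Finset.card_eq_sum_card_fiberwise (f := Subgroup.zpowers) (t := T) hT, Finset.mul_sum]
  refine Finset.sum_le_sum fun C hC => ?_
  obtain ⟨v, hv, rfl⟩ := Finset.mem_image.mp hC
  obtain ⟨b, -, rfl⟩ := Finset.mem_image.mp hv
  have := hfib b
  rw [← Set.ncard_coe_finset, ← Set.ncard_coe_finset]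
  convert this using 3 <;> ext x <;> simp [R]

end OmegaBound

section Transport

variable {p : ℕ} [Fact p.Prime] {G₁ G₂ : Type*}

theorem image_zpowers_eq [Group G₁] [Group G₂] (φ : G₁ ≃ G₂)
    (hφ : ∀ x y, x ∈ Subgroup.zpowers y ↔ φ x ∈ Subgroup.zpowers (φ y)) (y : G₁) :
    φ '' (Subgroup.zpowers y) = Subgroup.zpowers (φ y) := by
  ext b
  obtain ⟨x, rfl⟩ := φ.surjective b
  rw [φ.injective.mem_set_image]
  exact hφ x y

theorem orderOf_apply_eq [Group G₁] [Group G₂] (φ : G₁ ≃ G₂)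
    (hφ : ∀ x y, x ∈ Subgroup.zpowers y ↔ φ x ∈ Subgroup.zpowers (φ y)) (y : G₁) :
    orderOf (φ y) = orderOf y := by
  rw [← ncard_zpowers, ← ncard_zpowers, ← image_zpowers_eq φ hφ,
    Set.ncard_image_of_injective _ φ.injective]

theorem apply_pow_eq_one_iff [Group G₁] [Group G₂] (φ : G₁ ≃ G₂)
    (hφ : ∀ x y, x ∈ Subgroup.zpowers y ↔ φ x ∈ Subgroup.zpowers (φ y)) (y : G₁) (n : ℕ) :
    φ y ^ n = 1 ↔ y ^ n = 1 := by
  rw [← orderOf_dvd_iff_pow_eq_one, ← orderOf_dvd_iff_pow_eq_one, orderOf_apply_eq φ hφ]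

theorem IsPGroup.mem_zpowers_pow_iff {G : Type*} [Group G] (hG : IsPGroup p G) {x y : G}
    (hy : y ≠ 1) : x ∈ Subgroup.zpowers (y ^ p) ↔
      x ∈ Subgroup.zpowers y ∧ y ∉ Subgroup.zpowers x :=
  ⟨fun h => ⟨(hG.zpowers_pow_lt hy).le h, fun h' =>
    hy (hG.eq_one_of_mem_zpowers_pow (Subgroup.zpowers_le.mpr h h'))⟩,
    fun h => (hG.mem_zpowers_or_mem_zpowers_pow h.1).resolve_left h.2⟩

theorem mem_zpowers_pow_iff_apply [Group G₁] [Group G₂] (h₁ : IsPGroup p G₁) (h₂ : IsPGroup p G₂)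
    (φ : G₁ ≃ G₂) (hφ : ∀ x y, x ∈ Subgroup.zpowers y ↔ φ x ∈ Subgroup.zpowers (φ y)) (x y : G₁) :
    x ∈ Subgroup.zpowers (y ^ p) ↔ φ x ∈ Subgroup.zpowers (φ y ^ p) := by
  have h1 := apply_pow_eq_one_iff φ hφ y 1
  rw [pow_one, pow_one] at h1
  by_cases hy : y = 1
  · have := hφ x y
    rw [h1.mpr hy, hy] at this ⊢
    rwa [one_pow, one_pow]
  · rw [h₁.mem_zpowers_pow_iff hy, h₂.mem_zpowers_pow_iff (fun h => hy (h1.mp h)), hφ, hφ]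

variable [CommGroup G₁] [Finite G₁] [Group G₂]

theorem ncard_closure_pair_le_of_equiv (φ : G₁ ≃ G₂)
    (hφ : ∀ x y, x ∈ Subgroup.zpowers y ↔ φ x ∈ Subgroup.zpowers (φ y))
    (hT : ∀ {t x y : G₁}, t ^ p = 1 → t ∉ Subgroup.closure {x, y} →
      φ t ∉ Subgroup.closure {φ x, φ y}) (a b : G₂) :
    {w : G₂ | w ∈ Subgroup.closure {a, b} ∧ w ^ p = 1}.ncard ≤ p ^ 2 := by
  obtain ⟨x, rfl⟩ := φ.surjective a
  obtain ⟨y, rfl⟩ := φ.surjective b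
  refine le_trans ?_ (ncard_closure_pair_pow_eq_one_le (p := p) x y)
  rw [← Set.ncard_image_of_injective _ φ.injective]
  refine Set.ncard_le_ncard ?_ (Set.toFinite _)
  rintro w ⟨hw, hwp⟩
  obtain ⟨t, rfl⟩ := φ.surjective w
  rw [apply_pow_eq_one_iff φ hφ] at hwp
  exact ⟨t, ⟨not_imp_not.mp (hT hwp) hw, hwp⟩, rfl⟩

theorem pow_mem_zpowers_pow_iff_of_equiv [Finite G₂] (h₁ : IsPGroup p G₁) (h₂ : IsPGroup p G₂)
    (φ : G₁ ≃ G₂) (hφ : ∀ x y, x ∈ Subgroup.zpowers y ↔ φ x ∈ Subgroup.zpowers (φ y))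
    (hQ : ∀ a b : G₂, {w : G₂ | w ∈ Subgroup.closure {a, b} ∧ w ^ p = 1}.ncard ≤ p ^ 2) (b x : G₂) :
    x ^ p ∈ Subgroup.zpowers (b ^ p) ↔ ∃ k : ℤ, (b ^ k * x) ^ p = 1 := by
  obtain ⟨y, rfl⟩ := φ.surjective b
  have hE := mem_zpowers_pow_iff_apply h₁ h₂ φ hφ
  have hsub : {x : G₂ | ∃ k : ℤ, (φ y ^ k * x) ^ p = 1} ⊆
      {x : G₂ | x ^ p ∈ Subgroup.zpowers (φ y ^ p)} := by
    rintro x ⟨k, hk⟩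
    have h1 := h₂.mul_pow_mem_zpowers hQ (g := φ y ^ (-k)) hk
    rw [← mul_assoc, ← zpow_add, neg_add_cancel, zpow_zero, one_mul] at h1
    refine Subgroup.zpowers_le (H := Subgroup.zpowers (φ y ^ p)).mpr ?_ h1
    exact ⟨-k, by simp only [← zpow_natCast, ← zpow_mul, mul_comm]⟩
  have hB : {x : G₂ | x ^ p ∈ Subgroup.zpowers (φ y ^ p)} =
      φ '' {x : G₁ | x ^ p ∈ Subgroup.zpowers (y ^ p)} := by
    ext x
    obtain ⟨x, rfl⟩ := φ.surjective x
    rw [φ.injective.mem_set_image]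
    change φ x ^ p ∈ Subgroup.zpowers _ ↔ x ^ p ∈ Subgroup.zpowers _
    rw [← Subgroup.zpowers_le, ← Subgroup.zpowers_le]
    constructor
    · exact fun h z hz => (hE z y).mpr (h ((hE z x).mp hz))
    · intro h w hw
      obtain ⟨z, rfl⟩ := φ.surjective w
      exact (hE z y).mp (h ((hE z x).mpr hw))
  have hA : {x : G₁ | x ^ p ∈ Subgroup.zpowers (y ^ p)} ⊆
      {x : G₁ | ∃ k : ℤ, (y ^ k * x) ^ p = 1} := by
    rintro x ⟨k, hk⟩
    refine ⟨-k, ?_⟩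
    have hk : (y ^ p) ^ k = x ^ p := hk
    rw [mul_pow, ← hk, ← zpow_natCast, ← zpow_natCast, ← zpow_mul, ← zpow_mul, ← zpow_add]
    simp [mul_comm]
  have hW : {w : G₂ | w ^ p = 1}.ncard = {w : G₁ | w ^ p = 1}.ncard := by
    rw [← Set.ncard_image_of_injective _ φ.injective]
    congr 1
    ext w
    obtain ⟨w, rfl⟩ := φ.surjective w
    rw [φ.injective.mem_set_image]
    exact apply_pow_eq_one_iff φ hφ w p
  have hord : orderOf (φ y ^ p) = orderOf (y ^ p) := by
    rw [← ncard_zpowers, ← ncard_zpowers, ← Set.ncard_image_of_injective _ φ.injective]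
    congr 1
    ext w
    obtain ⟨w, rfl⟩ := φ.surjective w
    rw [φ.injective.mem_set_image]
    exact (hE w y).symm
  have heq := Set.eq_of_subset_of_ncard_le hsub (by
    rw [ncard_zpow_mul_pow_eq_one (fun x y => h₂.commute_of_ncard_closure_pair_le hQ), hW, hord, hB,
      Set.ncard_image_of_injective _ φ.injective,
      ← ncard_zpow_mul_pow_eq_one (fun x y _ _ => Commute.all x y)]
    exact Set.ncard_le_ncard hA (Set.toFinite _)) (Set.toFinite _)
  exact (Set.ext_iff.mp heq x).symm

end Transport

theorem two_generated_subgroups_metacyclic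
    (p : ℕ) (hp : p.Prime) (G₁ G₂ : Type) [CommGroup G₁] [Finite G₁]
    [Group G₂] [Finite G₂] (h₁ : IsPGroup p G₁) (h₂ : IsPGroup p G₂)
    (h : (∃ φ : G₁ ≃ G₂, ∀ X : Set G₁, Independent X ↔ Independent (φ '' X)) ∨
         (∃ φ : G₁ ≃ G₂, ∀ X : Set G₁,
            StronglyIndependent X ↔ StronglyIndependent (φ '' X))) :
    ∀ K : Subgroup G₂, dgen K = 2 →
      ∃ N : Subgroup ↥K, ∃ _ : N.Normal, IsCyclic ↥N ∧ IsCyclic (↥K ⧸ N) := by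
  intro K hK
  have := Fact.mk hp
  obtain ⟨φ, h⟩ : ∃ φ : G₁ ≃ G₂, (∀ X : Set G₁, Independent X ↔ Independent (φ '' X)) ∨
      ∀ X : Set G₁, StronglyIndependent X ↔ StronglyIndependent (φ '' X) := by
    rcases h with ⟨φ, h⟩ | ⟨φ, h⟩
    exacts [⟨φ, Or.inl h⟩, ⟨φ, Or.inr h⟩]
  obtain ⟨a, b, rfl⟩ := exists_eq_closure_pair_of_dgen_le_two hK.le
  have hcmp := comparable_iff_of_independent_iff h₁ h₂ φ h
  by_cases hcyc : IsCyclic G₁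
  · have hdgen : ∀ {x y : G₂}, x ∈ Subgroup.zpowers y → dgen (Subgroup.closure {x, y}) ≤ 1 :=
      fun {x y} hxy => (dgen_le (S := {y}) (by
        rw [closure_pair_eq_zpowers hxy, Subgroup.zpowers_eq_closure])).trans_eq
          (Set.ncard_singleton y)
    obtain ⟨g, hg⟩ := hcyc.exists_generator
    have hab := (hcmp _ _).mp (h₁.mem_zpowers_total (hg (φ.symm a)) (hg (φ.symm b)))
    rw [φ.apply_symm_apply, φ.apply_symm_apply] at hab
    rcases hab with hab | hab
    · have := hdgen hab
      omega
    · have := hdgen hab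
      rw [Set.pair_comm] at this
      omega
  have hφ := mem_zpowers_iff_of_comparable_iff h₁ h₂ hcyc φ hcmp
  have hQ := ncard_closure_pair_le_of_equiv φ hφ
    fun {t x y} ht => notMem_closure_pair_of_independent_iff h₁ φ h hφ ht
  refine exists_cyclic_extension_of_card_le (h₂.to_subgroup _) (closure_pair_subtype_eq_top a b)
    ((h₂.to_subgroup _).card_le_of_pow_mem_zpowers_pow_iff ?_ ?_ ?_)
  · exact fun x y hx hy => Subtype.ext (h₂.commute_of_ncard_closure_pair_le hQ
      (congrArg Subtype.val hx) (congrArg Subtype.val hy))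
  · intro c x
    have := pow_mem_zpowers_pow_iff_of_equiv h₁ h₂ φ hφ hQ c x
    simp only [Subgroup.mem_zpowers_iff, Subtype.ext_iff] at this ⊢
    exact_mod_cast this
  · rw [ncard_subtype_pow_eq_one]
    exact hQ a b
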